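/- Let φ, ρ be weights on (0,1) with φ, ρ > 0 on (0,1), ρ Lipschitz on (0,1), φ ∈ C(0,1) ∩ L^∞(0,1), and 1/φ ∈ L^∞_loc(0,1), and let F ∈ W^{1,2}_{1,1/φ}(0,1) with F(0) = 0. Then the weighted taut string problem min{ (1/2)∫_0^1 (Ũ'(s))²/φ(s) ds : Ũ ∈ W^{1,2}_{1,1/φ}(0,1), |Ũ − F| ≤ αρ, Ũ(0) = 0, Ũ(1) = F(1) } has a unique minimizer. -/

import Mathlib

open MeasureTheory Set Filter Topology
open scoped ENNReal NNReal

noncomputable section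

/-- The weighted total variation `TV_ρ` on `(0,1)`:
`TV_ρ(u) = sup {∫ u z' : z ∈ C¹_c(0,1), |z| ≤ ρ}`. -/
def TVw (ρ : ℝ → ℝ) (u : ℝ → ℝ) : EReal :=
  sSup ((fun z => ((∫ x in Set.Ioo (0:ℝ) 1, u x * deriv z x : ℝ) : EReal)) ''
    {z : ℝ → ℝ | ContDiff ℝ 1 z ∧ HasCompactSupport z ∧ tsupport z ⊆ Set.Ioo 0 1 ∧
      ∀ x ∈ Set.Ioo (0:ℝ) 1, |z x| ≤ ρ x})

/-- Membership in the weighted Lebesgue space `L²_φ(0,1)`. -/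
def MemL2w (φ u : ℝ → ℝ) : Prop :=
  AEMeasurable u (volume.restrict (Set.Ioo (0:ℝ) 1)) ∧
  IntegrableOn (fun x => u x ^ 2 * φ x) (Set.Ioo (0:ℝ) 1)

/-- Objective of the weighted ROF (denoising) problem `∫ (u-f)² φ + α TV_ρ(u)`. -/
def EROF (φ ρ f : ℝ → ℝ) (α : ℝ) (u : ℝ → ℝ) : EReal :=
  ((∫ x in Set.Ioo (0:ℝ) 1, (u x - f x) ^ 2 * φ x : ℝ) : EReal) + (α : EReal) * TVw ρ u

/-- `u₀` is a minimizer of the weighted ROF problem over `L²_φ(0,1)`. -/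
def IsEROFMinimizer (φ ρ f : ℝ → ℝ) (α : ℝ) (u₀ : ℝ → ℝ) : Prop :=
  MemL2w φ u₀ ∧ ∀ u, MemL2w φ u → EROF φ ρ f α u₀ ≤ EROF φ ρ f α u

/-- Standing assumptions on the weights `φ, ρ` on `(0,1)`: positivity, `ρ` Lipschitz,
`φ` continuous and bounded, `1/φ` locally bounded in `(0,1)`. -/
structure WeightsOK (φ ρ : ℝ → ℝ) : Prop where
  φ_pos : ∀ x ∈ Set.Ioo (0:ℝ) 1, 0 < φ x
  ρ_pos : ∀ x ∈ Set.Ioo (0:ℝ) 1, 0 < ρ x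
  ρ_lip : ∃ L : ℝ≥0, LipschitzOnWith L ρ (Set.Ioo (0:ℝ) 1)
  φ_cont : ContinuousOn φ (Set.Ioo (0:ℝ) 1)
  φ_bdd : ∃ M : ℝ, ∀ x ∈ Set.Ioo (0:ℝ) 1, φ x ≤ M
  inv_φ_loc : ∀ K : Set ℝ, K ⊆ Set.Ioo (0:ℝ) 1 → IsCompact K →
    ∃ c : ℝ, ∀ x ∈ K, 1 / φ x ≤ c

/-- `g` is the derivative of `U` in the sense that `U` is the integral of `g`, with
`g ∈ L²_{1/φ}(0,1)`; this realizes `U ∈ W^{1,2}_{1,1/φ}(0,1)` (continuous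
representative). -/
def RepDeriv (φ U g : ℝ → ℝ) : Prop :=
  IntegrableOn g (Set.Ioo (0:ℝ) 1) ∧
  IntegrableOn (fun x => g x ^ 2 / φ x) (Set.Ioo (0:ℝ) 1) ∧
  ∀ x ∈ Set.Icc (0:ℝ) 1, U x = U 0 + ∫ t in Set.Ioc (0:ℝ) x, g t

/-- Membership in the weighted Sobolev space `W^{1,2}_{1,1/φ}(0,1)`. -/
def MemW (φ U : ℝ → ℝ) : Prop :=
  IntegrableOn (fun x => U x ^ 2) (Set.Ioo (0:ℝ) 1) ∧ ∃ g, RepDeriv φ U g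

/-- Admissibility for the weighted taut string problem: `Ũ ∈ W^{1,2}_{1,1/φ}(0,1)`,
`|Ũ − F| ≤ αρ` on `(0,1)`, `Ũ(0) = 0`, `Ũ(1) = F(1)`. -/
def TSAdm (φ ρ F : ℝ → ℝ) (α : ℝ) (U : ℝ → ℝ) : Prop :=
  MemW φ U ∧ (∀ x ∈ Set.Ioo (0:ℝ) 1, |U x - F x| ≤ α * ρ x) ∧ U 0 = 0 ∧ U 1 = F 1

/-- Energy of the weighted taut string problem, expressed via the derivative `g = Ũ'`. -/
def TSE (φ g : ℝ → ℝ) : ℝ :=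
  (1 / 2) * ∫ x in Set.Ioo (0:ℝ) 1, g x ^ 2 / φ x

/-- A complete convex nonempty set in a real inner product space has a unique element of minimal
norm. -/
theorem exists_unique_norm_minimizer {E : Type*} [NormedAddCommGroup E] [InnerProductSpace ℝ E]
    {K : Set E} (hne : K.Nonempty) (hc : IsComplete K) (hK : Convex ℝ K) :
    ∃ v ∈ K, (∀ w ∈ K, ‖v‖ ≤ ‖w‖) ∧ ∀ w ∈ K, ‖w‖ ≤ ‖v‖ → w = v := by
  obtain ⟨v, hv, hmin⟩ := exists_norm_eq_iInf_of_complete_convex hne hc hK 0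
  have hinner := (norm_eq_iInf_iff_real_inner_le_zero hK hv).1 hmin
  have key : ∀ w ∈ K, ‖v‖ ^ 2 + ‖w - v‖ ^ 2 ≤ ‖w‖ ^ 2 := by
    intro w hw
    have h := hinner w hw
    rw [zero_sub, inner_neg_left] at h
    have hn := norm_add_sq_real v (w - v)
    rw [add_sub_cancel] at hn
    linarith
  refine ⟨v, hv, fun w hw => ?_, fun w hw hwv => ?_⟩
  · have := key w hw
    exact (sq_le_sq₀ (norm_nonneg _) (norm_nonneg _)).1 (by nlinarith [sq_nonneg ‖w - v‖])
  · have h1 := key w hw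
    have h2 : ‖w‖ ^ 2 ≤ ‖v‖ ^ 2 := by gcongr
    have h3 : ‖w - v‖ ^ 2 = 0 := le_antisymm (by linarith) (sq_nonneg _)
    exact sub_eq_zero.1 (norm_eq_zero.1 (pow_eq_zero_iff two_ne_zero |>.1 h3))

/-- The unweighted space `L²(0,1)`, which the map `h ↦ √φ h` identifies with `L²_{1/φ}(0,1)`. -/
abbrev L2Unit : Type := Lp ℝ 2 (volume.restrict (Ioo (0:ℝ) 1))

namespace WeightsOK

variable {φ ρ : ℝ → ℝ}

theorem aestronglyMeasurable_sqrt (hW : WeightsOK φ ρ) :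
    AEStronglyMeasurable (fun x => √(φ x)) (volume.restrict (Ioo (0:ℝ) 1)) :=
  (hW.φ_cont.sqrt).aestronglyMeasurable measurableSet_Ioo

theorem memLp_top_sqrt (hW : WeightsOK φ ρ) :
    MemLp (fun x => √(φ x)) ∞ (volume.restrict (Ioo (0:ℝ) 1)) := by
  obtain ⟨M, hM⟩ := hW.φ_bdd
  refine memLp_top_of_bound hW.aestronglyMeasurable_sqrt (√M) ?_
  filter_upwards [ae_restrict_mem measurableSet_Ioo] with x hx
  rw [Real.norm_of_nonneg (Real.sqrt_nonneg _)]
  exact Real.sqrt_le_sqrt (hM x hx)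

theorem memLp_two_sqrt_mul (hW : WeightsOK φ ρ) (h : L2Unit) :
    MemLp (fun x => √(φ x) * h x) 2 (volume.restrict (Ioo (0:ℝ) 1)) :=
  (Lp.memLp h).mul hW.memLp_top_sqrt

theorem sq_div_ae_eq (hW : WeightsOK φ ρ) {g : ℝ → ℝ} {h : L2Unit}
    (hg : g =ᵐ[volume.restrict (Ioo (0:ℝ) 1)] fun x => √(φ x) * h x) :
    (fun x => g x ^ 2 / φ x) =ᵐ[volume.restrict (Ioo (0:ℝ) 1)] fun x => h x ^ 2 := by
  filter_upwards [hg, ae_restrict_mem measurableSet_Ioo] with x hx hx1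
  have hφ := hW.φ_pos x hx1
  rw [hx, mul_pow, Real.sq_sqrt hφ.le]
  field_simp

theorem TSE_eq (hW : WeightsOK φ ρ) {g : ℝ → ℝ} {h : L2Unit}
    (hg : g =ᵐ[volume.restrict (Ioo (0:ℝ) 1)] fun x => √(φ x) * h x) :
    TSE φ g = 1 / 2 * ‖h‖ ^ 2 := by
  rw [TSE, integral_congr_ae (hW.sq_div_ae_eq hg), ← real_inner_self_eq_norm_sq, L2.inner_def]
  simp [pow_two]

theorem exists_ae_eq_sqrt_mul (hW : WeightsOK φ ρ) {U g : ℝ → ℝ} (hg : RepDeriv φ U g) :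
    ∃ h : L2Unit, g =ᵐ[volume.restrict (Ioo (0:ℝ) 1)] fun x => √(φ x) * h x := by
  have hm : AEStronglyMeasurable (fun x => g x / √(φ x)) (volume.restrict (Ioo (0:ℝ) 1)) :=
    (hg.1.aestronglyMeasurable.aemeasurable.div
      hW.aestronglyMeasurable_sqrt.aemeasurable).aestronglyMeasurable
  have hL : MemLp (fun x => g x / √(φ x)) 2 (volume.restrict (Ioo (0:ℝ) 1)) := by
    refine (memLp_two_iff_integrable_sq hm).2 (hg.2.1.congr ?_)
    filter_upwards [ae_restrict_mem measurableSet_Ioo] with x hx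
    rw [div_pow, Real.sq_sqrt (hW.φ_pos x hx).le]
  refine ⟨hL.toLp _, ?_⟩
  filter_upwards [hL.coeFn_toLp, ae_restrict_mem measurableSet_Ioo] with x hx hx1
  have := Real.sqrt_pos.2 (hW.φ_pos x hx1)
  rw [hx]
  field_simp

theorem integrableOn_sqrt_mul (hW : WeightsOK φ ρ) (h : L2Unit) :
    IntegrableOn (fun x => √(φ x) * h x) (Ioo (0:ℝ) 1) :=
  (hW.memLp_two_sqrt_mul h).integrable one_le_two

theorem repDeriv_primitive (hW : WeightsOK φ ρ) (h : L2Unit) :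
    RepDeriv φ (fun x => ∫ t in Ioc 0 x, √(φ t) * h t) fun x => √(φ x) * h x := by
  refine ⟨hW.integrableOn_sqrt_mul h, ?_, fun x _ => by simp⟩
  exact ((Lp.memLp h).integrable_sq).congr (hW.sq_div_ae_eq ae_eq_rfl).symm

theorem memW_primitive (hW : WeightsOK φ ρ) (h : L2Unit) :
    MemW φ (fun x => ∫ t in Ioc 0 x, √(φ t) * h t) := by
  refine ⟨?_, _, hW.repDeriv_primitive h⟩
  have hc : ContinuousOn (fun x => ∫ t in Ioc 0 x, √(φ t) * h t) (Icc 0 1) :=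
    intervalIntegral.continuousOn_primitive
      ((integrableOn_Icc_iff_integrableOn_Ioo enorm_ne_top enorm_ne_top).2
        (hW.integrableOn_sqrt_mul h))
  exact (hc.pow 2).integrableOn_Icc.mono_set Ioo_subset_Icc_self

/-- The primitive of `√φ h` at a fixed point is a continuous linear functional of `h`. -/
theorem exists_clm_primitive (hW : WeightsOK φ ρ) {x : ℝ} (hx : x ∈ Icc (0:ℝ) 1) :
    ∃ T : L2Unit →L[ℝ] ℝ, ∀ h : L2Unit, ∫ t in Ioc 0 x, √(φ t) * h t = T h := by
  have hs : MemLp (fun t => √(φ t)) 2 (volume.restrict (Ioo (0:ℝ) 1)) :=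
    hW.memLp_top_sqrt.mono_exponent le_top
  have hi : MemLp ((Ioc 0 x).indicator fun t => √(φ t)) 2 (volume.restrict (Ioo (0:ℝ) 1)) :=
    hs.indicator measurableSet_Ioc
  refine ⟨innerSL ℝ (hi.toLp _), fun h => ?_⟩
  have h1 : (∫ t in Ioc 0 x, √(φ t) * h t) =
      ∫ t in Ioc (0:ℝ) 1, (Ioc 0 x).indicator (fun t => √(φ t) * h t) t := by
    rw [setIntegral_indicator measurableSet_Ioc,
      inter_eq_right.2 (Ioc_subset_Ioc_right hx.2)]
  rw [h1, innerSL_apply_apply, L2.inner_def, integral_Ioc_eq_integral_Ioo]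
  refine integral_congr_ae ?_
  filter_upwards [hi.coeFn_toLp] with t ht
  rw [ht]
  by_cases htx : t ∈ Ioc 0 x <;> simp [htx, mul_comm]

end WeightsOK

theorem setIntegral_Ioc_congr_ae_Ioo {f g : ℝ → ℝ} {x : ℝ} (hx : x ≤ 1)
    (hfg : f =ᵐ[volume.restrict (Ioo (0:ℝ) 1)] g) :
    ∫ t in Ioc 0 x, f t = ∫ t in Ioc 0 x, g t := by
  rw [Measure.restrict_congr_set Ioo_ae_eq_Ioc] at hfg
  exact integral_congr_ae (ae_restrict_of_ae_restrict_of_subset (Ioc_subset_Ioc_right hx) hfg)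

/-- well-posedness of the weighted taut string problem.  Let `φ, ρ` be
weights as in `WeightsOK`, and `F ∈ W^{1,2}_{1,1/φ}(0,1)` with `F(0) = 0`.  Then the
problem `min { (1/2)∫ (Ũ')²/φ : Ũ ∈ W^{1,2}_{1,1/φ}(0,1), |Ũ−F| ≤ αρ, Ũ(0)=0,
Ũ(1)=F(1) }` has a unique minimizer. -/
theorem statement_9
    (φ ρ F : ℝ → ℝ) (α : ℝ) (hα : 0 < α)
    (hW : WeightsOK φ ρ) (hF : MemW φ F) (hF0 : F 0 = 0) :
    ∃ U₀ g₀, TSAdm φ ρ F α U₀ ∧ RepDeriv φ U₀ g₀ ∧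
      (∀ U g, TSAdm φ ρ F α U → RepDeriv φ U g → TSE φ g₀ ≤ TSE φ g) ∧
      ∀ U₁ g₁, TSAdm φ ρ F α U₁ → RepDeriv φ U₁ g₁ →
        (∀ U g, TSAdm φ ρ F α U → RepDeriv φ U g → TSE φ g₁ ≤ TSE φ g) →
        ∀ x ∈ Set.Icc (0:ℝ) 1, U₁ x = U₀ x := by
  set P : L2Unit → ℝ → ℝ := fun h x => ∫ t in Ioc 0 x, √(φ t) * h t with hP
  set K : Set L2Unit :=
    (⋂ x ∈ Ioo (0:ℝ) 1, {h | |P h x - F x| ≤ α * ρ x}) ∩ {h | P h 1 = F 1} with hKdef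
  have hmemK : ∀ h, h ∈ K ↔ (∀ x ∈ Ioo (0:ℝ) 1, |P h x - F x| ≤ α * ρ x) ∧ P h 1 = F 1 := by
    intro h
    simp [hKdef]
  have hball : ∀ (x : ℝ) (T : L2Unit →L[ℝ] ℝ), (∀ h, P h x = T h) →
      {h | |P h x - F x| ≤ α * ρ x} = T ⁻¹' Metric.closedBall (F x) (α * ρ x) := by
    intro x T hT
    ext h
    simp [hT, Real.dist_eq]
  have hsing : ∀ (T : L2Unit →L[ℝ] ℝ), (∀ h, P h 1 = T h) →
      {h | P h 1 = F 1} = T ⁻¹' {F 1} := by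
    intro T hT
    ext h
    simp [hT]
  obtain ⟨T₁, hT₁⟩ := hW.exists_clm_primitive (right_mem_Icc.2 zero_le_one)
  have hclosed : IsClosed K := by
    refine (isClosed_biInter fun x hx => ?_).inter ?_
    · obtain ⟨T, hT⟩ := hW.exists_clm_primitive (Ioo_subset_Icc_self hx)
      rw [hball x T hT]
      exact Metric.isClosed_closedBall.preimage T.continuous
    · rw [hsing T₁ hT₁]
      exact isClosed_singleton.preimage T₁.continuous
  have hconvex : Convex ℝ K := by
    refine (convex_iInter₂ fun x hx => ?_).inter ?_
    · obtain ⟨T, hT⟩ := hW.exists_clm_primitive (Ioo_subset_Icc_self hx)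
      rw [hball x T hT]
      exact (convex_closedBall _ _).linear_preimage T.toLinearMap
    · rw [hsing T₁ hT₁]
      exact (convex_singleton _).linear_preimage T₁.toLinearMap
  have hrep : ∀ U g, U 0 = 0 → RepDeriv φ U g →
      ∃ h : L2Unit, TSE φ g = 1 / 2 * ‖h‖ ^ 2 ∧ ∀ x ∈ Icc (0:ℝ) 1, U x = P h x := by
    intro U g hU0 hg
    obtain ⟨h, hh⟩ := hW.exists_ae_eq_sqrt_mul hg
    refine ⟨h, hW.TSE_eq hh, fun x hx => ?_⟩
    rw [hg.2.2 x hx, hU0, zero_add, setIntegral_Ioc_congr_ae_Ioo hx.2 hh]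
  have hadm : ∀ U g, TSAdm φ ρ F α U → RepDeriv φ U g →
      ∃ h ∈ K, TSE φ g = 1 / 2 * ‖h‖ ^ 2 ∧ ∀ x ∈ Icc (0:ℝ) 1, U x = P h x := by
    intro U g hU hg
    obtain ⟨h, hE, hUP⟩ := hrep U g hU.2.2.1 hg
    refine ⟨h, (hmemK h).2 ⟨fun x hx => ?_, ?_⟩, hE, hUP⟩
    · rw [← hUP x (Ioo_subset_Icc_self hx)]
      exact hU.2.1 x hx
    · rw [← hUP 1 (right_mem_Icc.2 zero_le_one)]
      exact hU.2.2.2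
  have hne : K.Nonempty := by
    obtain ⟨g, hg⟩ := hF.2
    have hFadm : TSAdm φ ρ F α F :=
      ⟨hF, fun x hx => by simpa using (mul_pos hα (hW.ρ_pos x hx)).le, hF0, rfl⟩
    obtain ⟨h, hh, -⟩ := hadm F g hFadm hg
    exact ⟨h, hh⟩
  obtain ⟨v, hv, hmin, huniq⟩ := exists_unique_norm_minimizer hne hclosed.isComplete hconvex
  have hvE : TSE φ (fun x => √(φ x) * v x) = 1 / 2 * ‖v‖ ^ 2 := hW.TSE_eq ae_eq_rfl
  have hvadm : TSAdm φ ρ F α (P v) :=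
    ⟨hW.memW_primitive v, ((hmemK v).1 hv).1, by simp [hP], ((hmemK v).1 hv).2⟩
  refine ⟨P v, fun x => √(φ x) * v x, hvadm, hW.repDeriv_primitive v, ?_, ?_⟩
  · intro U g hU hg
    obtain ⟨h, hh, hE, -⟩ := hadm U g hU hg
    rw [hvE, hE]
    gcongr
    exact hmin h hh
  · intro U₁ g₁ hU₁ hg₁ hmin₁ x hx
    obtain ⟨h, hh, hE, hUP⟩ := hadm U₁ g₁ hU₁ hg₁
    have hle := hmin₁ _ _ hvadm (hW.repDeriv_primitive v)
    rw [hvE, hE] at hle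
    have hnorm : ‖h‖ ≤ ‖v‖ := (sq_le_sq₀ (norm_nonneg _) (norm_nonneg _)).1 (by linarith)
    rw [hUP x hx, huniq h hh hnorm]
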